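/- arXiv:1408.3572 — 3 statements merged into one kernel-verified Lean document; each statement's English description precedes it below -/
import Mathlib

section
/- Let n ∈ ℤ, n ≥ 2, let t₀ > 0 and g = diag(e^{t₀}, e^{−t₀}) ∈ SL₂(ℝ), and let h: 𝕋 → X₂ be the continuous map induced by h₂ (well defined since h₂(s+1) = h₂(s) in X₂). Let ν be a T_n-invariant, ergodic Borel probability measure on 𝕋, and let μ_{X₂} be a Borel probability measure on X₂ invariant under the left SL₂(ℝ)-action. Suppose there exist c with 0 < c ≤ 1 and a strictly increasing sequence of natural numbers (N_ℓ) such that for every continuous compactly supported function f: X₂ → ℝ, (1/N_ℓ)·Σ_{k=0}^{N_ℓ−1} ∫_𝕋 f(gᵏ·h(s)) dν(s) → c·∫_{X₂} f dμ_{X₂} as ℓ → ∞. Then ν({s ∈ 𝕋 : the closure of {gᵏ·h(s) : k ∈ ℕ} equals X₂}) = 1. -/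
open MeasureTheory Matrix Filter Set
open scoped ENNReal

noncomputable section

/-- Topology on special linear groups (induced from the matrix topology). -/
instance (n : Type*) [DecidableEq n] [Fintype n] (R : Type*) [CommRing R] [TopologicalSpace R] :
    TopologicalSpace (Matrix.SpecialLinearGroup n R) :=
  TopologicalSpace.induced (fun A => (A : Matrix n n R)) inferInstance

abbrev SL2R := Matrix.SpecialLinearGroup (Fin 2) ℝ
abbrev SL2Z := Matrix.SpecialLinearGroup (Fin 2) ℤ

/-- The image of `SL₂(ℤ)` in `SL₂(ℝ)`. -/
def SL2Zsub : Subgroup SL2R :=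
  MonoidHom.range (Matrix.SpecialLinearGroup.map (n := Fin 2) (Int.castRingHom ℝ))

/-- The space of unimodular lattices `X₂ = SL₂(ℝ)/SL₂(ℤ)`. -/
abbrev X2 := SL2R ⧸ SL2Zsub

/-- `h₂(s)` is the class of the matrix `[[1, s], [0, 1]]` in `X₂`. -/
def h2 (s : ℝ) : X2 :=
  QuotientGroup.mk ⟨!![(1:ℝ), s; 0, 1], by simp [Matrix.det_fin_two_of]⟩

/-- The diagonal matrix `diag(e^t, e^{-t}) ∈ SL₂(ℝ)`. -/
def g2 (t : ℝ) : SL2R :=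
  ⟨!![Real.exp t, 0; 0, Real.exp (-t)], by
    simp [Matrix.det_fin_two_of, ← Real.exp_add]⟩

/-- The circle `𝕋 = ℝ/ℤ`. -/
abbrev Circ := UnitAddCircle

theorem coeFn_birkhoffAverage_compMeasurePreserving {X : Type*} [MeasurableSpace X]
    {μ : Measure X} {T : X → X} (hT : MeasurePreserving T μ μ) {F : X → ℝ} (hF : MemLp F 2 μ)
    (M : ℕ) :
    (birkhoffAverage ℝ (Lp.compMeasurePreservingₗᵢ ℝ T hT : Lp ℝ 2 μ → Lp ℝ 2 μ) id M
      (hF.toLp F) : Lp ℝ 2 μ) =ᵐ[μ] birkhoffAverage ℝ T F M := by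
  have iter (k : ℕ) : ((Lp.compMeasurePreservingₗᵢ ℝ T hT : Lp ℝ 2 μ → Lp ℝ 2 μ)^[k]
      (hF.toLp F) : Lp ℝ 2 μ) =ᵐ[μ] fun x => F (T^[k] x) := by
    induction k with
    | zero => exact hF.coeFn_toLp
    | succ k ih =>
      rw [Function.iterate_succ_apply']
      refine (Lp.coeFn_compMeasurePreserving _ hT).trans ?_
      filter_upwards [hT.quasiMeasurePreserving.ae ih] with x hx
      simpa using hx
  have hsum : (birkhoffSum (Lp.compMeasurePreservingₗᵢ ℝ T hT : Lp ℝ 2 μ → Lp ℝ 2 μ) id M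
      (hF.toLp F) : Lp ℝ 2 μ) =ᵐ[μ] birkhoffSum T F M := by
    induction M with
    | zero => exact Lp.coeFn_zero _ _ _
    | succ k ih =>
      rw [birkhoffSum_succ]
      refine (Lp.coeFn_add _ _).trans ?_
      filter_upwards [ih, iter k] with x h1 h2
      simp only [Pi.add_apply, birkhoffSum_succ, id, h1, h2]
  refine (Lp.coeFn_smul _ _).trans ?_
  filter_upwards [hsum] with x hx
  simp [birkhoffAverage, hx]

theorem tendsto_integral_abs_birkhoffAverage {X : Type*} [MeasurableSpace X]
    {μ : Measure X} [IsProbabilityMeasure μ] {T : X → X} (hT : Ergodic T μ) {F : X → ℝ}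
    (hF : MemLp F 2 μ) (h0 : ∫ x, F x ∂μ = 0) :
    Tendsto (fun M => ∫ x, |birkhoffAverage ℝ T F M x| ∂μ) atTop (nhds 0) := by
  set U := Lp.compMeasurePreservingₗᵢ ℝ T hT.toMeasurePreserving (E := ℝ) (p := 2)
  have hU : ‖U.toContinuousLinearMap‖ ≤ 1 := U.norm_toContinuousLinearMap_le
  have hlim := U.toContinuousLinearMap.tendsto_birkhoffAverage_orthogonalProjection hU (hF.toLp F)
  set P : Lp ℝ 2 μ := ((U.toContinuousLinearMap.eqLocus
    (1 : Lp ℝ 2 μ →L[ℝ] Lp ℝ 2 μ)).orthogonalProjectionOnto (hF.toLp F) : Lp ℝ 2 μ) with hPdef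
  have hPfix : U P = P :=
    ((U.toContinuousLinearMap.eqLocus (1 : Lp ℝ 2 μ →L[ℝ] Lp ℝ 2 μ)).orthogonalProjectionOnto
      (hF.toLp F)).2
  obtain ⟨κ, hκ⟩ := hT.ae_eq_const_of_ae_eq_comp_ae (Lp.aestronglyMeasurable P) (by
    have h1 := Lp.coeFn_compMeasurePreserving P hT.toMeasurePreserving
    have h2 : Lp.compMeasurePreserving T hT.toMeasurePreserving P = P := hPfix
    rw [h2] at h1
    exact h1.symm)
  have hP : P = Lp.const 2 μ κ := by
    apply Lp.ext
    exact hκ.trans (Lp.coeFn_const _ _ _).symm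
  have hUone : U (Lp.const 2 μ (1 : ℝ)) = Lp.const 2 μ (1 : ℝ) := rfl
  have hinner : inner ℝ (Lp.const 2 μ (1 : ℝ)) (hF.toLp F) = 0 := by
    rw [L2.inner_def, ← h0]
    apply integral_congr_ae
    filter_upwards [Lp.coeFn_const (p := 2) (μ := μ) (1 : ℝ), hF.coeFn_toLp] with x h1 h2
    simp [h2]
  have hκ0 : κ = 0 := by
    have h1 := Submodule.inner_orthogonalProjectionOnto_eq_of_mem_left
      (K := U.toContinuousLinearMap.eqLocus (1 : Lp ℝ 2 μ →L[ℝ] Lp ℝ 2 μ))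
      ⟨Lp.const 2 μ (1 : ℝ), hUone⟩ (hF.toLp F)
    rw [hinner] at h1
    change inner ℝ (Lp.const 2 μ (1 : ℝ)) P = 0 at h1
    rw [hP, L2.inner_def] at h1
    rw [← h1]
    have : ∫ _, κ ∂μ = κ := by simp
    rw [← this]
    apply integral_congr_ae
    filter_upwards with x
    simp
  have hP0 : P = 0 := by rw [hP, hκ0]; simp
  rw [hP0] at hlim
  refine squeeze_zero (fun M => integral_nonneg fun x => abs_nonneg _) (fun M => ?_)
    (by simpa using hlim.norm)
  have hae := coeFn_birkhoffAverage_compMeasurePreserving hT.toMeasurePreserving hF M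
  have hle := eLpNorm_le_eLpNorm_of_exponent_le (μ := μ) (p := 1) (q := 2) (by norm_num)
    (Lp.aestronglyMeasurable (birkhoffAverage ℝ (⇑U) id M (hF.toLp F)))
  rw [Lp.norm_def]
  refine le_trans (le_of_eq ?_) (ENNReal.toReal_mono (Lp.eLpNorm_ne_top _) hle)
  rw [eLpNorm_one_eq_lintegral_enorm, ← integral_norm_eq_lintegral_enorm
    (Lp.aestronglyMeasurable _)]
  apply integral_congr_ae
  filter_upwards [hae] with x hx
  rw [Real.norm_eq_abs, ← hx]

theorem birkhoffAverage_birkhoffAverage {X : Type*} (T : X → X) (F : X → ℝ) (M n : ℕ) (y : X) :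
    birkhoffAverage ℝ T (birkhoffAverage ℝ T F M) n y =
      (M : ℝ)⁻¹ * ∑ j ∈ Finset.range M, birkhoffAverage ℝ T F n (T^[j] y) := by
  simp only [birkhoffAverage, birkhoffSum, smul_eq_mul, Finset.mul_sum]
  rw [Finset.sum_comm]
  refine Finset.sum_congr rfl fun j _ => Finset.sum_congr rfl fun k _ => ?_
  rw [← Function.iterate_add_apply, ← Function.iterate_add_apply, add_comm]
  ring

theorem abs_birkhoffAverage_iterate_sub_le {X : Type*} (T : X → X) {F : X → ℝ} {C : ℝ}
    (hF : ∀ x, |F x| ≤ C) (n j : ℕ) (y : X) :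
    |birkhoffAverage ℝ T F n (T^[j] y) - birkhoffAverage ℝ T F n y| ≤ j * (2 * C / n) := by
  induction j with
  | zero => simp
  | succ j ih =>
    have h1 : |birkhoffAverage ℝ T F n (T (T^[j] y)) - birkhoffAverage ℝ T F n (T^[j] y)| ≤
        2 * C / n := by
      rw [birkhoffAverage_apply_sub_birkhoffAverage, smul_eq_mul, abs_mul, abs_inv, Nat.abs_cast,
        inv_mul_eq_div]
      gcongr
      calc _ ≤ |F (T^[n] (T^[j] y))| + |F (T^[j] y)| := abs_sub _ _
        _ ≤ 2 * C := by linarith [hF (T^[n] (T^[j] y)), hF (T^[j] y)]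
    rw [Function.iterate_succ_apply']
    push_cast
    calc _ ≤ _ := abs_sub_le _ (birkhoffAverage ℝ T F n (T^[j] y)) _
      _ ≤ _ := by linarith

theorem abs_birkhoffAverage_birkhoffAverage_sub_le {X : Type*} (T : X → X) {F : X → ℝ} {C : ℝ}
    (hF : ∀ x, |F x| ≤ C) {M : ℕ} (hM : 0 < M) (n : ℕ) (y : X) :
    |birkhoffAverage ℝ T (birkhoffAverage ℝ T F M) n y - birkhoffAverage ℝ T F n y| ≤
      M * (2 * C / n) := by
  have hM' : (M : ℝ) ≠ 0 := by positivity
  have hC : 0 ≤ C := (abs_nonneg _).trans (hF y)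
  have h : birkhoffAverage ℝ T (birkhoffAverage ℝ T F M) n y - birkhoffAverage ℝ T F n y =
      (M : ℝ)⁻¹ * ∑ j ∈ Finset.range M,
        (birkhoffAverage ℝ T F n (T^[j] y) - birkhoffAverage ℝ T F n y) := by
    rw [birkhoffAverage_birkhoffAverage, Finset.sum_sub_distrib, mul_sub]
    simp [hM']
  rw [h, abs_mul, abs_inv, Nat.abs_cast, inv_mul_le_iff₀ (by positivity)]
  calc _ ≤ ∑ j ∈ Finset.range M,
        |birkhoffAverage ℝ T F n (T^[j] y) - birkhoffAverage ℝ T F n y| :=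
        Finset.abs_sum_le_sum_abs _ _
    _ ≤ ∑ _j ∈ Finset.range M, (M : ℝ) * (2 * C / n) := by
        refine Finset.sum_le_sum fun j hj => ?_
        refine (abs_birkhoffAverage_iterate_sub_le T hF n j y).trans ?_
        have : j ≤ M := (Finset.mem_range.1 hj).le
        gcongr
    _ = _ := by simp

theorem HasCompactSupport.birkhoffAverage {X : Type*} [TopologicalSpace X] (T : X ≃ₜ X)
    {F : X → ℝ} (hF : HasCompactSupport F) (M : ℕ) :
    HasCompactSupport (birkhoffAverage ℝ T F M) := by
  have iter (k : ℕ) : HasCompactSupport fun x => F (T^[k] x) := by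
    induction k with
    | zero => exact hF
    | succ k ih => exact ih.comp_homeomorph T
  have hsum : HasCompactSupport (birkhoffSum T F M) := by
    induction M with
    | zero => rw [birkhoffSum_zero']; exact HasCompactSupport.zero
    | succ M ih =>
      have : birkhoffSum T F (M + 1) = birkhoffSum T F M + fun x => F (T^[M] x) :=
        funext fun x => birkhoffSum_succ ..
      rw [this]
      exact ih.add (iter M)
  exact hsum.smul_left (f := fun _ => (M : ℝ)⁻¹)

theorem Continuous.birkhoffAverage {X : Type*} [TopologicalSpace X] {T : X → X}
    (hT : Continuous T) {F : X → ℝ} (hF : Continuous F) (M : ℕ) :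
    Continuous (birkhoffAverage ℝ T F M) := by
  have := hT.iterate
  unfold _root_.birkhoffAverage birkhoffSum
  fun_prop

theorem birkhoffAverage_le_one {X : Type*} (T : X → X) {F : X → ℝ} (h : ∀ x, F x ≤ 1) (M : ℕ)
    (x : X) : birkhoffAverage ℝ T F M x ≤ 1 := by
  calc _ ≤ (M : ℝ)⁻¹ * ∑ _k ∈ Finset.range M, (1 : ℝ) :=
        mul_le_mul_of_nonneg_left (Finset.sum_le_sum fun _ _ => h _) (by positivity)
    _ ≤ 1 := by simpa using inv_mul_le_one

theorem abs_birkhoffAverage_le {X : Type*} (T : X → X) (F : X → ℝ) (M : ℕ) (x : X) :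
    |birkhoffAverage ℝ T F M x| ≤ birkhoffAverage ℝ T (fun x => |F x|) M x := by
  simp only [birkhoffAverage, birkhoffSum, smul_eq_mul, abs_mul, abs_inv, Nat.abs_cast]
  gcongr
  exact Finset.abs_sum_le_sum_abs _ _

theorem integrable_birkhoffAverage_comp {X : Type*} [TopologicalSpace X] [MeasurableSpace X]
    [BorelSpace X] (T : X ≃ₜ X) {Y : Type*} [MeasurableSpace Y] {ν : Measure Y} [IsFiniteMeasure ν]
    {h : Y → X} (hh : Measurable h) {F : X → ℝ} (hF : Continuous F) (hFc : HasCompactSupport F)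
    (n : ℕ) : Integrable (fun y => birkhoffAverage ℝ T F n (h y)) ν := by
  obtain ⟨C, hC⟩ := (Continuous.birkhoffAverage T.continuous hF n).bounded_above_of_compact_support
    (hFc.birkhoffAverage T n)
  exact Integrable.of_bound ((Continuous.birkhoffAverage T.continuous hF n).measurable.comp
    hh).aestronglyMeasurable C (ae_of_all _ fun y => hC _)

section Escape

variable {X : Type*} [TopologicalSpace X] [MeasurableSpace X] [BorelSpace X] {μ : Measure X}
  [IsProbabilityMeasure μ] {T : X ≃ₜ X} {Y : Type*} [MeasurableSpace Y] {ν : Measure Y}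
  {h : Y → X} {c : ℝ} {N : ℕ → ℕ}

theorem tendsto_integral_abs_birkhoffAverage_comp [IsFiniteMeasure ν] (hT : Ergodic T μ)
    (hh : Measurable h) (hN : Tendsto N atTop atTop)
    (hconv : ∀ f : X → ℝ, Continuous f → HasCompactSupport f →
      Tendsto (fun ℓ => ∫ y, birkhoffAverage ℝ T f (N ℓ) (h y) ∂ν) atTop (nhds (c * ∫ x, f x ∂μ)))
    {F : X → ℝ} (hF : Continuous F) (hFc : HasCompactSupport F) (h0 : ∫ x, F x ∂μ = 0) :
    Tendsto (fun ℓ => ∫ y, |birkhoffAverage ℝ T F (N ℓ) (h y)| ∂ν) atTop (nhds 0) := by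
  obtain ⟨C, hC⟩ := hF.bounded_above_of_compact_support hFc
  have hmean := tendsto_integral_abs_birkhoffAverage hT
    (MemLp.of_bound hF.measurable.aestronglyMeasurable C (ae_of_all _ hC)) h0
  have hmean' := hmean.const_mul c
  rw [mul_zero] at hmean'
  rw [Metric.tendsto_atTop']
  intro ε hε
  obtain ⟨M, hMε, hM⟩ := ((hmean'.eventually_lt_const (half_pos hε)).and
    (eventually_gt_atTop 0)).exists
  set G : X → ℝ := fun x => |birkhoffAverage ℝ T F M x| with hG
  have hGcont : Continuous G := (Continuous.birkhoffAverage T.continuous hF M).abs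
  have hGc : HasCompactSupport G :=
    (hFc.birkhoffAverage T M).comp_left (g := fun x : ℝ => |x|) abs_zero
  have hbound : Tendsto (fun ℓ => (∫ y, birkhoffAverage ℝ T G (N ℓ) (h y) ∂ν) +
      ν.real univ * (M * (2 * C / (N ℓ : ℝ)))) atTop
      (nhds (c * ∫ x, G x ∂μ + ν.real univ * (M * 0))) := by
    refine (hconv G hGcont hGc).add (Tendsto.const_mul _ (Tendsto.const_mul _ ?_))
    exact tendsto_const_nhds.div_atTop (tendsto_natCast_atTop_atTop.comp hN)
  obtain ⟨ℓ₀, hℓ₀⟩ := eventually_atTop.1 (hbound.eventually_lt_const (u := ε) (by linarith))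
  refine ⟨ℓ₀, fun ℓ hℓ => ?_⟩
  rw [Real.dist_0_eq_abs, abs_of_nonneg (integral_nonneg fun _ => abs_nonneg _)]
  refine lt_of_le_of_lt ?_ (hℓ₀ ℓ hℓ.le)
  have hint := integrable_birkhoffAverage_comp T (ν := ν) hh hGcont hGc (N ℓ)
  calc _ ≤ ∫ y, (birkhoffAverage ℝ T G (N ℓ) (h y) + M * (2 * C / (N ℓ : ℝ))) ∂ν := by
        refine integral_mono (integrable_birkhoffAverage_comp T hh hF hFc _).abs
          (hint.add (integrable_const _)) fun y => ?_
        have h1 := abs_birkhoffAverage_birkhoffAverage_sub_le T hC hM (N ℓ) (h y)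
        have h2 := abs_birkhoffAverage_le T (birkhoffAverage ℝ T F M) (N ℓ) (h y)
        rw [abs_sub_comm] at h1
        have h3 := abs_sub_abs_le_abs_sub (birkhoffAverage ℝ T F (N ℓ) (h y))
          (birkhoffAverage ℝ T (birkhoffAverage ℝ T F M) (N ℓ) (h y))
        simp only [hG]
        linarith
    _ = _ := by
        rw [integral_add hint (integrable_const _)]
        simp

theorem tendsto_setIntegral_birkhoffAverage_comp [T2Space X] [LocallyCompactSpace X]
    [μ.IsOpenPosMeasure] [IsFiniteMeasure ν] (hT : Ergodic T μ)
    (hh : Measurable h) (hN : Tendsto N atTop atTop)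
    (hconv : ∀ f : X → ℝ, Continuous f → HasCompactSupport f →
      Tendsto (fun ℓ => ∫ y, birkhoffAverage ℝ T f (N ℓ) (h y) ∂ν) atTop (nhds (c * ∫ x, f x ∂μ)))
    {U : Set X} (hU : IsOpen U) (hne : U.Nonempty) {E : Set Y} (hE : MeasurableSet E)
    (hEU : ∀ y ∈ E, ∀ k, T^[k] (h y) ∉ U)
    {f : X → ℝ} (hf : Continuous f) (hfc : HasCompactSupport f) :
    Tendsto (fun ℓ => ∫ y in E, birkhoffAverage ℝ T f (N ℓ) (h y) ∂ν) atTop (nhds 0) := by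
  obtain ⟨x, hx⟩ := hne
  obtain ⟨u, hu1, hu0, huc, hu⟩ := exists_continuous_one_zero_of_isCompact
    (isCompact_singleton (x := x)) hU.isClosed_compl (by simpa using hx)
  have hupos : 0 < ∫ x, u x ∂μ := u.continuous.integral_pos_of_hasCompactSupport_nonneg_nonzero
    huc (fun x => (hu x).1) (x := x) (by simp [hu1 (mem_singleton x)])
  set b := (∫ x, f x ∂μ) / ∫ x, u x ∂μ
  set F : X → ℝ := f - b • ⇑u with hFdef
  have hF : Continuous F := hf.sub (u.continuous.const_smul b)
  have hFc : HasCompactSupport F := hfc.sub (huc.smul_left (f := fun _ => b))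
  have h0 : ∫ x, F x ∂μ = 0 := by
    simp only [hFdef, Pi.sub_apply, Pi.smul_apply]
    have hui : Integrable (fun x => b • u x) μ :=
      (u.continuous.integrable_of_hasCompactSupport huc).smul b
    rw [integral_sub (hf.integrable_of_hasCompactSupport hfc) hui, integral_smul, smul_eq_mul,
      div_mul_cancel₀ _ hupos.ne', sub_self]
  refine squeeze_zero_norm (fun ℓ => ?_)
    (tendsto_integral_abs_birkhoffAverage_comp hT hh hN hconv hF hFc h0)
  have hcongr : ∫ y in E, birkhoffAverage ℝ T f (N ℓ) (h y) ∂ν =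
      ∫ y in E, birkhoffAverage ℝ T F (N ℓ) (h y) ∂ν := by
    refine setIntegral_congr_fun hE fun y hy => ?_
    simp only [birkhoffAverage, birkhoffSum]
    congr 1
    refine Finset.sum_congr rfl fun k _ => ?_
    simp [hFdef, hu0 (hEU y hy k)]
  rw [hcongr]
  refine (norm_integral_le_integral_norm _).trans ?_
  exact setIntegral_le_integral (integrable_birkhoffAverage_comp T hh hF hFc _).abs
    (ae_of_all _ fun _ => abs_nonneg _)

theorem measure_dense_orbit_ne_zero [T2Space X] [LocallyCompactSpace X]
    [SecondCountableTopology X] [μ.IsOpenPosMeasure] [IsProbabilityMeasure ν] (hT : Ergodic T μ)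
    (hh : Measurable h) (hN : Tendsto N atTop atTop) (hc : 0 < c)
    (hconv : ∀ f : X → ℝ, Continuous f → HasCompactSupport f →
      Tendsto (fun ℓ => ∫ y, birkhoffAverage ℝ T f (N ℓ) (h y) ∂ν) atTop
        (nhds (c * ∫ x, f x ∂μ))) :
    MeasurableSet {y | Dense (range fun k : ℕ => T^[k] (h y))} ∧
      ν {y | Dense (range fun k : ℕ => T^[k] (h y))} ≠ 0 := by
  obtain ⟨x⟩ : Nonempty X := nonempty_of_isProbabilityMeasure μ
  have hB := TopologicalSpace.isBasis_countableBasis X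
  obtain ⟨V, hV⟩ := (TopologicalSpace.countable_countableBasis X).exists_eq_range
    (let ⟨v, hv, _⟩ := hB.exists_subset_of_mem_open (mem_univ x) isOpen_univ; ⟨v, hv⟩)
  have hVmem (i : ℕ) : V i ∈ TopologicalSpace.countableBasis X := hV ▸ mem_range_self i
  have hVo (i : ℕ) : IsOpen (V i) := hB.isOpen (hVmem i)
  have hVne (i : ℕ) : (V i).Nonempty := TopologicalSpace.nonempty_of_mem_countableBasis (hVmem i)
  set E : ℕ → Set Y := fun i => {y | ∀ k : ℕ, T^[k] (h y) ∉ V i}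
  have hEm (i : ℕ) : MeasurableSet (E i) := by
    have : E i = ⋂ k : ℕ, (fun y => T^[k] (h y)) ⁻¹' (V i)ᶜ := by
      ext y; simp [E]
    rw [this]
    exact MeasurableSet.iInter fun k =>
      ((T.continuous.iterate k).measurable.comp hh) (hVo i).measurableSet.compl
  have hD : {y | Dense (range fun k : ℕ => T^[k] (h y))} = (⋃ i, E i)ᶜ := by
    ext y
    simp only [mem_ofPred_eq, hB.dense_iff, hV, forall_mem_range, compl_iUnion, mem_iInter]
    refine forall_congr' fun i => ?_
    simpa [E, Set.Nonempty] using ⟨fun H => H _ (hVne i).some_mem, fun H _ _ => H⟩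
  refine ⟨hD ▸ (MeasurableSet.iUnion hEm).compl, fun hnull => ?_⟩
  obtain ⟨u, hu1, -, huc, hu⟩ := exists_continuous_one_zero_of_isCompact
    (isCompact_singleton (x := x)) isClosed_empty (disjoint_empty _)
  have hupos : 0 < ∫ x, u x ∂μ := u.continuous.integral_pos_of_hasCompactSupport_nonneg_nonzero
    huc (fun x => (hu x).1) (x := x) (by simp [hu1 (mem_singleton x)])
  set G := disjointed E
  have hGm (i : ℕ) : MeasurableSet (G i) := .disjointed hEm i
  have hGd : Pairwise (Function.onFun Disjoint G) := disjoint_disjointed E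
  have hlim (m : ℕ) : Tendsto (fun ℓ => ∑ i ∈ Finset.range m,
      ∫ y in G i, birkhoffAverage ℝ T u (N ℓ) (h y) ∂ν) atTop (nhds 0) := by
    rw [← Finset.sum_const_zero (s := Finset.range m)]
    exact tendsto_finsetSum _ fun i _ => tendsto_setIntegral_birkhoffAverage_comp hT hh hN hconv
      (hVo i) (hVne i) (hGm i) (fun y hy => disjointed_subset E i hy) u.continuous huc
  have hle (m : ℕ) : c * ∫ x, u x ∂μ ≤ ν.real (⋃ i ≥ m, G i) := by
    have hlim' := (hlim m).add_const (ν.real (⋃ i ≥ m, G i))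
    rw [zero_add] at hlim'
    refine le_of_tendsto_of_tendsto' (hconv u u.continuous huc) hlim' fun ℓ => ?_
    have hint := integrable_birkhoffAverage_comp T (ν := ν) hh u.continuous huc (N ℓ)
    have hSm : MeasurableSet (⋃ i ∈ Finset.range m, G i) :=
      Finset.measurableSet_biUnion _ fun i _ => hGm i
    rw [← integral_add_compl hSm hint, integral_biUnion_finset _ (fun i _ => hGm i)
      (fun i _ j _ hij => hGd hij) (fun i _ => hint.integrableOn)]
    gcongr
    calc _ ≤ ∫ y in (⋃ i ∈ Finset.range m, G i)ᶜ, (1 : ℝ) ∂ν := by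
          refine integral_mono hint.integrableOn (integrable_const _) fun y => ?_
          exact birkhoffAverage_le_one T (fun x => (hu x).2) _ _
      _ = ν.real (⋃ i ∈ Finset.range m, G i)ᶜ := by simp
      _ ≤ _ := by
          refine ENNReal.toReal_mono (measure_ne_top _ _) (measure_mono_ae ?_)
          have : ∀ᵐ y ∂ν, y ∈ ⋃ i, G i := by
            rw [iUnion_disjointed]
            rw [hD] at hnull
            exact hnull
          filter_upwards [this] with y hy hy'
          obtain ⟨i, hi⟩ := mem_iUnion.1 hy
          refine mem_iUnion₂.2 ⟨i, not_lt.1 fun him => hy' ?_, hi⟩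
          exact mem_iUnion₂.2 ⟨i, Finset.mem_range.2 him, hi⟩
  have hzero := (ENNReal.tendsto_toReal ENNReal.zero_ne_top).comp
    (tendsto_measure_biUnion_Ici_zero_of_pairwise_disjoint (μ := ν)
      (fun i => (hGm i).nullMeasurableSet) hGd)
  exact (mul_pos hc hupos).not_ge (ge_of_tendsto' hzero hle)

end Escape

theorem aeconst_of_forall_preimage_smul_ae_eq_of_isPretransitive {G X : Type*} [Group G]
    [TopologicalSpace G] [IsTopologicalGroup G] [LocallyCompactSpace G]
    [SecondCountableTopology G] [TopologicalSpace X] [SecondCountableTopology X]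
    [MeasurableSpace X] [BorelSpace X] [MulAction G X]
    [ContinuousSMul G X] [MulAction.IsPretransitive G X] {μ : Measure X} [SFinite μ]
    {s : Set X} (hsm : MeasurableSet s) (hs : ∀ γ : G, (γ • ·) ⁻¹' s =ᵐ[μ] s) :
    EventuallyConst s (ae μ) := by
  borelize G
  let m : Measure G := Measure.haar
  suffices (∃ᵐ x ∂μ, x ∈ s) → ∀ᵐ x ∂μ, x ∈ s by
    simp only [eventuallyConst_set, ← not_frequently]
    exact or_not_of_imp this
  intro hμs
  obtain ⟨a, has, ha⟩ : ∃ a ∈ s, ∀ᵐ b ∂m, (b • a ∈ s ↔ a ∈ s) := by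
    refine (hμs.and_eventually ?_).exists
    rw [Measure.ae_ae_comm]
    · exact ae_of_all _ fun b ↦ (hs b).mem_iff
    · exact ((hsm.preimage (measurable_snd.smul measurable_fst)).mem.iff
        (hsm.preimage measurable_fst).mem).setOf
  have hall : ∀ᵐ x ∂μ, ∀ᵐ b ∂m, b • x ∈ s := ae_of_all _ fun x => by
    obtain ⟨γ, rfl⟩ := MulAction.exists_smul_eq G a x
    filter_upwards [(quasiMeasurePreserving_mul_right m γ).ae ha] with b hb
    rw [smul_smul]
    exact hb.2 has
  rw [Measure.ae_ae_comm (p := fun x b => b • x ∈ s)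
    (hsm.preimage (measurable_snd.smul measurable_fst))] at hall
  obtain ⟨b, hb⟩ := hall.exists
  filter_upwards [hb, (hs b).mem_iff] with x h1 h2
  exact h2.1 h1

theorem smul_Lp_eq_of_tendsto_conj {G X : Type*} [Group G] [TopologicalSpace G]
    [TopologicalSpace X] [R1Space X] [MeasurableSpace X] [BorelSpace X] [MulAction G X]
    [ContinuousSMul G X] {μ : Measure X} [IsFiniteMeasure μ] [μ.InnerRegularCompactLTTop]
    [SMulInvariantMeasure G X μ] {v : Lp ℝ 1 μ} {w : ℕ → G} {u : G}
    (hw : ∀ k, DomMulAct.mk (w k) • v = v)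
    (hu : Tendsto (fun k => (w k)⁻¹ * u * w k) atTop (nhds 1)) :
    DomMulAct.mk u • v = v := by
  borelize G
  have : Fact ((1 : ℝ≥0∞) ≠ ∞) := ⟨ENNReal.one_ne_top⟩
  have hcont : Continuous fun γ : G => dist (DomMulAct.mk γ • v) v := by
    have : Continuous (DomMulAct.mk : G → Gᵈᵐᵃ) := DomMulAct.continuous_mk
    fun_prop
  have hlim := (hcont.tendsto 1).comp hu
  have hconst (k : ℕ) : dist (DomMulAct.mk ((w k)⁻¹ * u * w k) • v) v =
      dist (DomMulAct.mk u • v) v := by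
    have hinv : DomMulAct.mk (w k)⁻¹ • v = v := by
      conv_lhs => rw [← hw k]
      rw [smul_smul, ← DomMulAct.mk_mul, mul_inv_cancel, DomMulAct.mk_one, one_smul]
    rw [DomMulAct.mk_mul, DomMulAct.mk_mul, mul_smul, mul_smul, hinv]
    conv_lhs => rw [← hw k]
    rw [hw k, ← DomMulAct.dist_smul_Lp (DomMulAct.mk (w k)) (DomMulAct.mk u • v) v, hw k]
  rw [← dist_eq_zero]
  simp only [Function.comp_def, hconst, DomMulAct.mk_one, one_smul, dist_self] at hlim
  exact tendsto_nhds_unique tendsto_const_nhds hlim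

theorem eq_univ_of_isClosed_of_image_subset {X : Type*} [TopologicalSpace X] [MeasurableSpace X]
    [BorelSpace X] {μ : Measure X} [IsFiniteMeasure μ] [μ.IsOpenPosMeasure] {T : X → X}
    (hT : Ergodic T μ) {C : Set X} (hC : IsClosed C) (hint : (interior C).Nonempty)
    (hTC : T '' C ⊆ C) : C = univ := by
  rcases hT.ae_empty_or_univ_of_image_ae_le hC.measurableSet.nullMeasurableSet
    hTC.eventuallyLE with h | h
  · exact absurd (measure_mono_null interior_subset (ae_eq_empty.1 h))
      (isOpen_interior.measure_ne_zero μ hint)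
  · rw [← compl_empty_iff, ← hC.isOpen_compl.measure_eq_zero_iff μ]
    exact ae_eq_univ.1 h

theorem isClosedEmbedding_val_SL2R :
    Topology.IsClosedEmbedding (fun A : SL2R => (A : Matrix (Fin 2) (Fin 2) ℝ)) :=
  Matrix.SpecialLinearGroup.isClosedEmbedding_val

instance : IsTopologicalGroup SL2R := Matrix.SpecialLinearGroup.topologicalGroup
instance : LocallyCompactSpace SL2R :=
  have : LocallyCompactSpace (Matrix (Fin 2) (Fin 2) ℝ) :=
    inferInstanceAs (LocallyCompactSpace (Fin 2 → Fin 2 → ℝ))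
  isClosedEmbedding_val_SL2R.locallyCompactSpace
instance : T2Space SL2R := isClosedEmbedding_val_SL2R.isEmbedding.t2Space
instance : SecondCountableTopology SL2R :=
  have : SecondCountableTopology (Matrix (Fin 2) (Fin 2) ℝ) :=
    inferInstanceAs (SecondCountableTopology (Fin 2 → Fin 2 → ℝ))
  isClosedEmbedding_val_SL2R.isEmbedding.secondCountableTopology

theorem isClosed_SL2Zsub : IsClosed (SL2Zsub : Set SL2R) := by
  have : Topology.IsClosedEmbedding (Int.castRingHom ℝ) := Int.isClosedEmbedding_coe_real
  exact this.specialLinearGroup_map.isClosed_range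

instance : T2Space X2 := by
  have hq : IsOpenQuotientMap (QuotientGroup.mk : SL2R → X2) :=
    QuotientGroup.isOpenQuotientMap_mk
  rw [t2Space_iff_of_isOpenQuotientMap hq]
  have : {q : SL2R × SL2R | (QuotientGroup.mk q.1 : X2) = QuotientGroup.mk q.2} =
      (fun q : SL2R × SL2R => q.1⁻¹ * q.2) ⁻¹' SL2Zsub := by
    ext q
    simp [QuotientGroup.eq]
  rw [this]
  exact isClosed_SL2Zsub.preimage (by fun_prop)

/-- The upper unipotent matrix `[[1, x], [0, 1]]`. -/
def upperUnipotent (x : ℝ) : SL2R := ⟨!![1, x; 0, 1], by simp [Matrix.det_fin_two_of]⟩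

/-- The lower unipotent matrix `[[1, 0], [x, 1]]`. -/
def lowerUnipotent (x : ℝ) : SL2R := ⟨!![1, 0; x, 1], by simp [Matrix.det_fin_two_of]⟩

@[simp] theorem coe_upperUnipotent (x : ℝ) :
    (upperUnipotent x : Matrix (Fin 2) (Fin 2) ℝ) = !![1, x; 0, 1] := rfl

@[simp] theorem coe_lowerUnipotent (x : ℝ) :
    (lowerUnipotent x : Matrix (Fin 2) (Fin 2) ℝ) = !![1, 0; x, 1] := rfl

@[simp] theorem coe_g2 (t : ℝ) :
    (g2 t : Matrix (Fin 2) (Fin 2) ℝ) = !![Real.exp t, 0; 0, Real.exp (-t)] := rfl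

theorem eq_top_of_unipotent_mem {H : Subgroup SL2R} (hu : ∀ x, upperUnipotent x ∈ H)
    (hl : ∀ x, lowerUnipotent x ∈ H) : H = ⊤ := by
  have key (γ : SL2R) (hγ : γ.1 1 0 ≠ 0) : γ ∈ H := by
    have hdet := γ.2
    rw [Matrix.det_fin_two] at hdet
    have : γ = upperUnipotent ((γ.1 0 0 - 1) / γ.1 1 0) * lowerUnipotent (γ.1 1 0) *
        upperUnipotent ((γ.1 1 1 - 1) / γ.1 1 0) := by
      ext i j
      simp only [coe_upperUnipotent, coe_lowerUnipotent, Matrix.SpecialLinearGroup.coe_mul]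
      fin_cases i <;> fin_cases j <;> simp [Matrix.mul_apply, Fin.sum_univ_two] <;>
        field_simp <;> linarith
    rw [this]
    exact H.mul_mem (H.mul_mem (hu _) (hl _)) (hu _)
  rw [eq_top_iff]
  intro γ _
  by_cases hγ : γ.1 1 0 = 0
  · have hdet := γ.2
    rw [Matrix.det_fin_two, hγ, mul_zero, sub_zero] at hdet
    rw [← H.mul_mem_cancel_left (hl 1)]
    apply key
    simp only [coe_lowerUnipotent, Matrix.SpecialLinearGroup.coe_mul]
    simpa [Matrix.mul_apply, Fin.sum_univ_two, hγ] using left_ne_zero_of_mul_eq_one hdet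
  · exact key γ hγ

theorem g2_pow (t : ℝ) (k : ℕ) : g2 t ^ k = g2 (k * t) := by
  induction k with
  | zero =>
    ext i j
    fin_cases i <;> fin_cases j <;> simp
  | succ k ih =>
    rw [pow_succ, ih]
    ext i j
    simp only [coe_g2, Matrix.SpecialLinearGroup.coe_mul]
    fin_cases i <;> fin_cases j <;>
      simp [Matrix.mul_apply, Fin.sum_univ_two, ← Real.exp_add] <;> ring

theorem g2_inv (t : ℝ) : (g2 t)⁻¹ = g2 (-t) := by
  rw [inv_eq_iff_mul_eq_one]
  ext i j
  simp only [coe_g2, Matrix.SpecialLinearGroup.coe_mul]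
  fin_cases i <;> fin_cases j <;> simp [Matrix.mul_apply, Fin.sum_univ_two, ← Real.exp_add]

theorem g2_inv_mul_upperUnipotent_mul (t x : ℝ) :
    (g2 t)⁻¹ * upperUnipotent x * g2 t = upperUnipotent (Real.exp (-2 * t) * x) := by
  rw [g2_inv]
  ext i j
  simp only [coe_g2, coe_upperUnipotent, Matrix.SpecialLinearGroup.coe_mul]
  fin_cases i <;> fin_cases j <;>
    simp [Matrix.mul_apply, Fin.sum_univ_two, ← Real.exp_add]
  rw [mul_right_comm, ← Real.exp_add]
  ring_nf

theorem g2_mul_lowerUnipotent_mul_inv (t x : ℝ) :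
    g2 t * lowerUnipotent x * (g2 t)⁻¹ = lowerUnipotent (Real.exp (-2 * t) * x) := by
  rw [g2_inv]
  ext i j
  simp only [coe_g2, coe_lowerUnipotent, Matrix.SpecialLinearGroup.coe_mul]
  fin_cases i <;> fin_cases j <;>
    simp [Matrix.mul_apply, Fin.sum_univ_two, ← Real.exp_add]
  rw [mul_right_comm, ← Real.exp_add]
  ring_nf

theorem continuous_upperUnipotent : Continuous upperUnipotent := by
  rw [isClosedEmbedding_val_SL2R.isInducing.continuous_iff]
  refine continuous_matrix fun i j => ?_
  fin_cases i <;> fin_cases j <;> simp [upperUnipotent] <;> fun_prop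

theorem continuous_lowerUnipotent : Continuous lowerUnipotent := by
  rw [isClosedEmbedding_val_SL2R.isInducing.continuous_iff]
  refine continuous_matrix fun i j => ?_
  fin_cases i <;> fin_cases j <;> simp [lowerUnipotent] <;> fun_prop

theorem upperUnipotent_zero : upperUnipotent 0 = 1 := by
  ext i j
  fin_cases i <;> fin_cases j <;> simp [upperUnipotent]

theorem lowerUnipotent_zero : lowerUnipotent 0 = 1 := by
  ext i j
  fin_cases i <;> fin_cases j <;> simp [lowerUnipotent]

theorem ergodic_g2_smul {t : ℝ} (ht : 0 < t) {X : Type*} [TopologicalSpace X] [R1Space X]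
    [SecondCountableTopology X] [MeasurableSpace X] [BorelSpace X] [MulAction SL2R X]
    [ContinuousSMul SL2R X] [MulAction.IsPretransitive SL2R X] {μ : Measure X}
    [IsFiniteMeasure μ] [μ.InnerRegularCompactLTTop] [SMulInvariantMeasure SL2R X μ] :
    Ergodic (g2 t • · : X → X) μ := by
  refine ⟨measurePreserving_smul _ μ, ⟨fun s hs hfix => ?_⟩⟩
  refine aeconst_of_forall_preimage_smul_ae_eq_of_isPretransitive (G := SL2R) hs ?_
  set v : Lp ℝ 1 μ := indicatorConstLp 1 hs (measure_ne_top μ s) 1 with hv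
  have hdecay (x : ℝ) : Tendsto (fun k : ℕ => Real.exp (-2 * (k * t)) * x) atTop (nhds 0) := by
    have : Tendsto (fun k : ℕ => (k : ℝ) * (2 * t)) atTop atTop :=
      tendsto_natCast_atTop_atTop.atTop_mul_const (by positivity)
    simpa [mul_left_comm] using (Real.tendsto_exp_neg_atTop_nhds_zero.comp this).mul_const x
  let H : Subgroup SL2R :=
    { carrier := {γ | DomMulAct.mk γ • v = v}
      mul_mem' := fun {a b} ha hb => by
        rw [mem_ofPred_eq] at ha hb ⊢
        rw [DomMulAct.mk_mul, mul_smul, ha, hb]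
      one_mem' := one_smul _ v
      inv_mem' := fun {a} ha => by
        rw [mem_ofPred_eq] at ha ⊢
        rw [DomMulAct.mk_inv, inv_smul_eq_iff, ha] }
  have hg : g2 t ∈ H := by
    change DomMulAct.mk (g2 t) • v = v
    simp only [hv, DomMulAct.mk_smul_indicatorConstLp]
    congr
  have hgk (k : ℕ) : g2 (k * t) ∈ H := g2_pow t k ▸ H.pow_mem hg k
  have hH : H = ⊤ := by
    refine eq_top_of_unipotent_mem (fun x => ?_) fun x => ?_
    · refine smul_Lp_eq_of_tendsto_conj (w := fun k => g2 (k * t)) hgk ?_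
      simp only [g2_inv_mul_upperUnipotent_mul]
      exact upperUnipotent_zero ▸ (continuous_upperUnipotent.tendsto 0).comp (hdecay x)
    · refine smul_Lp_eq_of_tendsto_conj (w := fun k => (g2 (k * t))⁻¹)
        (fun k => H.inv_mem (hgk k)) ?_
      simp only [inv_inv, g2_mul_lowerUnipotent_mul_inv]
      exact lowerUnipotent_zero ▸ (continuous_lowerUnipotent.tendsto 0).comp (hdecay x)
  intro γ
  have hγ : DomMulAct.mk γ • v = v := (hH ▸ Subgroup.mem_top γ : γ ∈ H)
  rwa [hv, DomMulAct.mk_smul_indicatorConstLp, indicatorConstLp_inj _ _ _ _ one_ne_zero] at hγ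

theorem coe_g2_mul_mul_inv (t : ℝ) (γ : SL2R) :
    (g2 t * γ * (g2 t)⁻¹ : SL2R).1 =
      !![γ.1 0 0, Real.exp (2 * t) * γ.1 0 1; Real.exp (-(2 * t)) * γ.1 1 0, γ.1 1 1] := by
  rw [g2_inv, two_mul, Real.exp_add, neg_add, Real.exp_add]
  have h1 : Real.exp t * Real.exp (-t) = 1 := by rw [← Real.exp_add, add_neg_cancel, Real.exp_zero]
  ext i j
  simp only [coe_g2, Matrix.SpecialLinearGroup.coe_mul, neg_neg]
  fin_cases i <;> fin_cases j <;>
    simp [Matrix.mul_apply, Matrix.vecMul, dotProduct, Fin.sum_univ_two]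
  · linear_combination γ.1 0 0 * h1
  · ring
  · ring
  · linear_combination γ.1 1 1 * h1

theorem g2_commute (t t' : ℝ) : Commute (g2 t) (g2 t') := by
  ext i j
  simp only [coe_g2, Matrix.SpecialLinearGroup.coe_mul]
  fin_cases i <;> fin_cases j <;> simp [Matrix.mul_apply, Fin.sum_univ_two, mul_comm]

theorem exp_two_mul_half_log {n : ℕ} (hn : n ≠ 0) : Real.exp (2 * (Real.log n / 2)) = n := by
  rw [mul_div_cancel₀ _ two_ne_zero, Real.exp_log (by positivity)]

theorem g2_mul_upperUnipotent_mul_inv {n : ℕ} (hn : n ≠ 0) (x : ℝ) :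
    g2 (Real.log n / 2) * upperUnipotent x * (g2 (Real.log n / 2))⁻¹ =
      upperUnipotent (n * x) := by
  refine Subtype.ext ?_
  rw [coe_g2_mul_mul_inv, exp_two_mul_half_log hn]
  simp

theorem conj_mem_SL2Zsub_of_mem_Gamma {n : ℕ} (hn : n ≠ 0) {γ : SL2Z}
    (hγ : γ ∈ CongruenceSubgroup.Gamma n) :
    g2 (Real.log n / 2) * Matrix.SpecialLinearGroup.map (Int.castRingHom ℝ) γ *
      (g2 (Real.log n / 2))⁻¹ ∈ SL2Zsub := by
  have hdvd : (n : ℤ) ∣ γ.1 1 0 :=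
    (ZMod.intCast_zmod_eq_zero_iff_dvd _ n).1 (CongruenceSubgroup.Gamma_mem.1 hγ).2.2.1
  obtain ⟨d, hd⟩ := hdvd
  have hdet := γ.2
  rw [Matrix.det_fin_two, hd] at hdet
  obtain ⟨δ, hδ⟩ : ∃ δ : SL2Z, (δ : Matrix (Fin 2) (Fin 2) ℤ) =
      !![γ.1 0 0, n * γ.1 0 1; d, γ.1 1 1] :=
    ⟨⟨_, by rw [Matrix.det_fin_two_of]; linear_combination hdet⟩, rfl⟩
  refine ⟨δ, Matrix.SpecialLinearGroup.ext _ _ fun i j => ?_⟩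
  rw [coe_g2_mul_mul_inv, Matrix.SpecialLinearGroup.map_apply_coe, hδ, Real.exp_neg,
    Matrix.SpecialLinearGroup.map_apply_coe, exp_two_mul_half_log hn]
  fin_cases i <;> fin_cases j <;> simp [hd, hn]

theorem dense_orbit_h2_mul {t : ℝ} [MeasurableSpace X2] [BorelSpace X2] {μ : Measure X2}
    [IsFiniteMeasure μ] [μ.IsOpenPosMeasure] (hT : Ergodic (g2 t • · : X2 → X2) μ)
    {n : ℕ} (hn : n ≠ 0) {s : ℝ} (hs : Dense (range fun k : ℕ => g2 t ^ k • h2 s)) :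
    Dense (range fun k : ℕ => g2 t ^ k • h2 (n * s)) := by
  have : NeZero n := ⟨hn⟩
  have hq : IsOpenQuotientMap (QuotientGroup.mk : SL2R → X2) :=
    QuotientGroup.isOpenQuotientMap_mk
  let φ : SL2Z →* SL2R := Matrix.SpecialLinearGroup.map (Int.castRingHom ℝ)
  set a : SL2R := g2 (Real.log n / 2)
  set C : Set X2 := closure (range fun k : ℕ => g2 t ^ k • h2 (n * s)) with hC
  let K : Set SL2R := {y | (QuotientGroup.mk (a * y * a⁻¹) : X2) ∈ C}
  have hK : IsClosed K := isClosed_closure.preimage (hq.continuous.comp (by fun_prop))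
  have hmemK (k : ℕ) {γ : SL2Z} (hγ : γ ∈ CongruenceSubgroup.Gamma n) :
      g2 t ^ k * upperUnipotent s * φ γ ∈ K := by
    refine subset_closure ⟨k, ?_⟩
    have hcomm : a * g2 t ^ k = g2 t ^ k * a := ((g2_commute _ _).pow_right k).eq
    have : a * (g2 t ^ k * upperUnipotent s * φ γ) * a⁻¹ =
        g2 t ^ k * upperUnipotent (n * s) * (a * φ γ * a⁻¹) := by
      rw [← g2_mul_upperUnipotent_mul_inv hn]
      simp only [← mul_assoc, inv_mul_cancel_right, hcomm, a]
    rw [this, QuotientGroup.mk_mul_of_mem _ (conj_mem_SL2Zsub_of_mem_Gamma hn hγ)]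
    rfl
  let L (q : SL2Z ⧸ CongruenceSubgroup.Gamma n) : Set SL2R := (· * φ q.out) ⁻¹' K
  have hL (q) : IsClosed (L q) := hK.preimage (continuous_mul_const _)
  have hcover : ⋃ q, L q = univ := by
    rw [← (isClosed_iUnion_of_finite hL).closure_eq, ← dense_iff_closure_eq]
    refine (hs.preimage hq.isOpenMap).mono ?_
    rintro y ⟨k, hk⟩
    obtain ⟨γ, hγ⟩ : (g2 t ^ k * upperUnipotent s)⁻¹ * y ∈ SL2Zsub := QuotientGroup.eq.1 hk
    refine mem_iUnion.2 ⟨(γ⁻¹ : SL2Z), ?_⟩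
    have hy : y = g2 t ^ k * upperUnipotent s * φ γ := by rw [hγ, mul_inv_cancel_left]
    change y * φ _ ∈ K
    rw [hy, mul_assoc, ← map_mul]
    refine hmemK k ?_
    rw [← inv_mem_iff, _root_.mul_inv_rev]
    exact QuotientGroup.eq.1 (QuotientGroup.out_eq' _)
  obtain ⟨q, hqint⟩ := nonempty_interior_of_iUnion_of_closed hL hcover
  have hKint : (interior K).Nonempty := by
    obtain ⟨y, hy⟩ := hqint
    exact ⟨_, mem_interior.2 ⟨_, image_subset_iff.2 interior_subset,
      isOpenMap_mul_right (φ q.out) _ isOpen_interior, mem_image_of_mem _ hy⟩⟩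
  have hCint : (interior C).Nonempty := by
    obtain ⟨y, hy⟩ := hKint
    have hopen : IsOpenMap fun y : SL2R => (QuotientGroup.mk (a * y * a⁻¹) : X2) :=
      hq.isOpenMap.comp ((isOpenMap_mul_right a⁻¹).comp (isOpenMap_mul_left a))
    exact ⟨_, mem_interior.2 ⟨_, image_subset_iff.2 interior_subset,
      hopen _ isOpen_interior, mem_image_of_mem _ hy⟩⟩
  rw [dense_iff_closure_eq]
  refine eq_univ_of_isClosed_of_image_subset hT isClosed_closure hCint ?_
  refine (image_closure_subset_closure_image (continuous_const_smul _)).trans (closure_mono ?_)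
  rintro _ ⟨_, ⟨k, rfl⟩, rfl⟩
  exact ⟨k + 1, by simp only [pow_succ', mul_smul]⟩

theorem measure_of_dense_orbits_eq_one (n : ℤ) (hn : 2 ≤ n) (t₀ : ℝ) (ht₀ : 0 < t₀)
    [MeasurableSpace X2] [BorelSpace X2]
    (h : Circ → X2) (hcont : Continuous h) (hlift : ∀ s : ℝ, h (s : Circ) = h2 s)
    (ν : Measure Circ) [IsProbabilityMeasure ν] (hν : Ergodic (fun x : Circ => n • x) ν)
    (μ : Measure X2) [IsProbabilityMeasure μ]
    (hμ : ∀ γ : SL2R, Measure.map (fun x : X2 => γ • x) μ = μ)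
    (c : ℝ) (hc0 : 0 < c) (hc1 : c ≤ 1) (N : ℕ → ℕ) (hN : StrictMono N)
    (hconv : ∀ f : X2 → ℝ, Continuous f → HasCompactSupport f →
      Filter.Tendsto
        (fun ℓ : ℕ => (1 / (N ℓ : ℝ)) * ∑ k ∈ Finset.range (N ℓ), ∫ x, f ((g2 t₀) ^ k • h x) ∂ν)
        Filter.atTop (nhds (c * ∫ x, f x ∂μ))) :
    ν {x : Circ | closure (Set.range fun k : ℕ => (g2 t₀) ^ k • h x) = Set.univ} = 1 := by
  have : SMulInvariantMeasure SL2R X2 μ := ⟨fun γ s hs => by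
    conv_rhs => rw [← hμ γ, Measure.map_apply (measurable_const_smul γ) hs]⟩
  have : μ.IsOpenPosMeasure := ⟨fun U hU hne =>
    measure_isOpen_pos_of_smulInvariant_of_ne_zero SL2R (IsProbabilityMeasure.ne_zero μ) hU hne
      |>.ne'⟩
  have herg : Ergodic (g2 t₀ • · : X2 → X2) μ := ergodic_g2_smul ht₀
  have hiter (k : ℕ) (x : X2) : (Homeomorph.smul (g2 t₀))^[k] x = g2 t₀ ^ k • x :=
    smul_iterate_apply (g2 t₀) k x
  have hconv' (f : X2 → ℝ) (hf : Continuous f) (hfc : HasCompactSupport f) :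
      Tendsto (fun ℓ => ∫ y, birkhoffAverage ℝ (Homeomorph.smul (g2 t₀)) f (N ℓ) (h y) ∂ν)
        atTop (nhds (c * ∫ x, f x ∂μ)) := by
    refine (hconv f hf hfc).congr fun ℓ => ?_
    have hint (k : ℕ) : Integrable (fun x => f (g2 t₀ ^ k • h x)) ν :=
      (by fun_prop : Continuous fun x => f (g2 t₀ ^ k • h x)).integrable_of_hasCompactSupport
        (HasCompactSupport.of_compactSpace _)
    simp only [birkhoffAverage, birkhoffSum, hiter, smul_eq_mul]
    rw [integral_const_mul, integral_finsetSum _ fun k _ => hint k, one_div]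
  obtain ⟨hmeas, hne⟩ := measure_dense_orbit_ne_zero (T := Homeomorph.smul (g2 t₀)) herg
    hcont.measurable hN.tendsto_atTop hc0 hconv'
  simp only [hiter] at hmeas hne
  simp only [← dense_iff_closure_eq]
  set A : Set Circ := {x | Dense (range fun k : ℕ => g2 t₀ ^ k • h x)}
  have hsub : A ⊆ (fun x : Circ => n • x) ⁻¹' A := by
    intro x hx
    obtain ⟨s, rfl⟩ := QuotientAddGroup.mk_surjective x
    lift n to ℕ using by omega
    have hns : (n : ℤ) • (s : Circ) = ((n * s : ℝ) : Circ) := by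
      rw [← AddCircle.coe_zsmul]
      simp
    change Dense _ at hx
    change Dense (range fun k : ℕ => g2 t₀ ^ k • h ((n : ℤ) • (s : Circ)))
    rw [hns, hlift]
    exact dense_orbit_h2_mul herg (by omega) (hlift s ▸ hx)
  rcases hν.ae_empty_or_univ_of_ae_le_preimage hmeas.nullMeasurableSet hsub.eventuallyLE
    with hA | hA
  · exact absurd (ae_eq_empty.1 hA) hne
  · rw [measure_congr hA, measure_univ]
end
end

section
/- Let X be a locally compact, second countable metric space, let g: X → X be a continuous map, and let m be a g-invariant, ergodic Borel probability measure on X with full support (supp m = X). Let Y be a measurable space, ν a probability measure on Y, and h: Y → X a measurable map. Suppose there exist c > 0 and a strictly increasing sequence of natural numbers (N_ℓ) such that for every continuous compactly supported function f: X → ℝ, (1/N_ℓ)·Σ_{k=0}^{N_ℓ−1} ∫_Y f(gᵏ(h(y))) dν(y) → c·∫_X f dm as ℓ → ∞. Then ν({y ∈ Y : the closure of {gᵏ(h(y)) : k ∈ ℕ} equals X}) > 0. -/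
open MeasureTheory Filter Set

noncomputable section

/-- The points whose orbit under an ergodic map avoids a set of positive measure form a null set. -/
theorem measure_setOf_forall_iterate_notMem_eq_zero {X : Type*} [MeasurableSpace X]
    {m : Measure X} [IsFiniteMeasure m] {g : X → X} (hm : Ergodic g m) {U : Set X}
    (hU : MeasurableSet U) (hpos : 0 < m U) : m {x | ∀ k : ℕ, g^[k] x ∉ U} = 0 := by
  have hmeas : MeasurableSet {x | ∀ k : ℕ, g^[k] x ∉ U} := by
    simp only [ofPred_forall]
    exact .iInter fun k => (hm.measurable.iterate k hU).compl
  have hsub : {x | ∀ k : ℕ, g^[k] x ∉ U} ⊆ g ⁻¹' {x | ∀ k : ℕ, g^[k] x ∉ U} :=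
    fun x hx k => hx (k + 1)
  rcases hm.ae_empty_or_univ_of_ae_le_preimage hmeas.nullMeasurableSet
    (LE.le.eventuallyLE hsub) with h | h
  · exact measure_eq_zero_iff_ae_notMem.2 (eventuallyEq_empty.1 h)
  · refine absurd (measure_mono_null ?_ (ae_eq_univ.1 h)) hpos.ne'
    exact fun x hx hx' => hx' 0 hx

/-- If the averaged laws of the orbits converge vaguely to `c • m`, then a closed forward invariant
`m`-null set cannot be the starting region of almost all the mass. -/
theorem mul_integral_le_measureReal_of_null_invariant
    {X : Type*} [MetricSpace X] [LocallyCompactSpace X] [MeasurableSpace X] [BorelSpace X]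
    {g : X → X} (hg : Continuous g) {m : Measure X} [IsProbabilityMeasure m]
    {Y : Type*} [MeasurableSpace Y] {ν : Measure Y} [IsProbabilityMeasure ν]
    {h : Y → X} (hh : Measurable h) {c : ℝ} (hc : 0 < c) {N : ℕ → ℕ}
    (hconv : ∀ f : X → ℝ, Continuous f → HasCompactSupport f →
      Tendsto (fun ℓ : ℕ => (1 / (N ℓ : ℝ)) * ∑ k ∈ Finset.range (N ℓ), ∫ y, f (g^[k] (h y)) ∂ν)
        atTop (nhds (c * ∫ x, f x ∂m)))
    {K : Set X} (hK : IsClosed K) (hK0 : m K = 0) (hinv : MapsTo g K K)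
    {f : X → ℝ} (hf : Continuous f) (hfc : HasCompactSupport f) (hf01 : ∀ x, f x ∈ Icc 0 1) :
    c * ∫ x, f x ∂m ≤ ν.real (h ⁻¹' Kᶜ) := by
  refine le_of_forall_pos_le_add fun ε hε => ?_
  obtain ⟨V, hVsub, hVo, hV⟩ := (K ∩ tsupport f).exists_isOpen_lt_of_lt (μ := m)
    (ENNReal.ofReal (ε / c)) (by
      rw [measure_mono_null inter_subset_left hK0]
      exact ENNReal.ofReal_pos.2 (div_pos hε hc))
  obtain ⟨φ, hφ1, hφ0, hφc, hφ01⟩ := exists_continuous_one_zero_of_isCompact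
    (hfc.isCompact.inter_left hK) hVo.isClosed_compl
    (disjoint_compl_right_iff_subset.2 hVsub)
  have hφm : c * ∫ x, φ x ∂m ≤ ε := by
    have h1 : ∫ x, φ x ∂m ≤ m.real V := by
      rw [← integral_indicator_one hVo.measurableSet]
      refine integral_mono_of_nonneg (.of_forall fun x => (hφ01 x).1)
        ((integrable_const (1 : ℝ)).indicator hVo.measurableSet) (.of_forall fun x => ?_)
      by_cases hx : x ∈ V
      · simpa [hx] using (hφ01 x).2
      · simpa [hx] using (hφ0 hx).le
    have h2 : m.real V ≤ ε / c :=
      ENNReal.toReal_le_of_le_ofReal (div_pos hε hc).le hV.le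
    calc c * ∫ x, φ x ∂m ≤ c * (ε / c) := by gcongr; exact h1.trans h2
      _ = ε := by field_simp
  have hKm : MeasurableSet (h ⁻¹' Kᶜ) := hh hK.measurableSet.compl
  have hint : ∀ ψ : X → ℝ, Continuous ψ → (∀ x, ψ x ∈ Icc 0 1) → ∀ k : ℕ,
      Integrable (fun y => ψ (g^[k] (h y))) ν := fun ψ hψ hψ01 k =>
    .of_mem_Icc 0 1 ((hψ.comp (hg.iterate k)).measurable.comp hh).aemeasurable
      (.of_forall fun y => hψ01 _)
  have hterm : ∀ k : ℕ, ∫ y, f (g^[k] (h y)) ∂ν ≤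
      (∫ y, φ (g^[k] (h y)) ∂ν) + ν.real (h ⁻¹' Kᶜ) := by
    intro k
    have hind : Integrable ((h ⁻¹' Kᶜ).indicator (1 : Y → ℝ)) ν :=
      (integrable_const (1 : ℝ)).indicator hKm
    rw [← integral_indicator_one hKm,
      ← integral_add (hint φ φ.continuous hφ01 k) hind]
    refine integral_mono (hint f hf hf01 k) ((hint φ φ.continuous hφ01 k).add hind) fun y => ?_
    by_cases hy : h y ∈ K
    · have hyk : g^[k] (h y) ∈ K := hinv.iterate k hy
      by_cases hs : g^[k] (h y) ∈ tsupport f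
      · simpa [hy, hφ1 ⟨hyk, hs⟩] using (hf01 (g^[k] (h y))).2
      · simpa [hy, image_eq_zero_of_notMem_tsupport hs] using (hφ01 (g^[k] (h y))).1
    · have h1 := (hf01 (g^[k] (h y))).2
      have h2 := (hφ01 (g^[k] (h y))).1
      simp [hy]
      linarith
  have hle := le_of_tendsto_of_tendsto' (hconv f hf hfc)
    ((hconv φ φ.continuous hφc).add_const (ν.real (h ⁻¹' Kᶜ))) fun ℓ => ?_
  · linarith
  · calc _ ≤ (1 / (N ℓ : ℝ)) * ∑ k ∈ Finset.range (N ℓ),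
          ((∫ y, φ (g^[k] (h y)) ∂ν) + ν.real (h ⁻¹' Kᶜ)) := by
          gcongr with k
          exact hterm k
      _ ≤ _ := by
          rw [Finset.sum_add_distrib, mul_add]
          gcongr
          rcases (N ℓ).eq_zero_or_pos with h0 | h0
          · simp [h0]
          · have : (N ℓ : ℝ) ≠ 0 := by positivity
            simp [this]

theorem positive_measure_of_dense_orbits
    {X : Type*} [MetricSpace X] [LocallyCompactSpace X] [SecondCountableTopology X]
    [MeasurableSpace X] [BorelSpace X]
    (g : X → X) (hg : Continuous g)
    (m : Measure X) [IsProbabilityMeasure m] (hm : Ergodic g m)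
    (hsupp : ∀ U : Set X, IsOpen U → U.Nonempty → 0 < m U)
    {Y : Type*} [MeasurableSpace Y] (ν : Measure Y) [IsProbabilityMeasure ν]
    (h : Y → X) (hh : Measurable h)
    (c : ℝ) (hc : 0 < c) (N : ℕ → ℕ) (hN : StrictMono N)
    (hconv : ∀ f : X → ℝ, Continuous f → HasCompactSupport f →
      Filter.Tendsto
        (fun ℓ : ℕ => (1 / (N ℓ : ℝ)) * ∑ k ∈ Finset.range (N ℓ), ∫ y, f (g^[k] (h y)) ∂ν)
        Filter.atTop (nhds (c * ∫ x, f x ∂m))) :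
    0 < ν {y : Y | closure (Set.range fun k : ℕ => g^[k] (h y)) = Set.univ} := by
  rw [pos_iff_ne_zero]
  intro hzero
  have : Nonempty X := nonempty_of_isProbabilityMeasure m
  obtain ⟨x₀⟩ := this
  have : m.IsOpenPosMeasure := ⟨fun U hU hne => (hsupp U hU hne).ne'⟩
  obtain ⟨f, hf1, -, hfc, hf01⟩ := exists_continuous_one_zero_of_isCompact
    (isCompact_singleton (x := x₀)) isClosed_empty (disjoint_empty _)
  have hfpos : 0 < ∫ x, f x ∂m :=
    f.continuous.integral_pos_of_hasCompactSupport_nonneg_nonzero hfc (fun x => (hf01 x).1)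
      (x := x₀) (by simp [hf1 (mem_singleton x₀)])
  obtain ⟨U, hU⟩ := (TopologicalSpace.countable_countableBasis X).exists_eq_range
    (((TopologicalSpace.isBasis_countableBasis X).exists_subset_of_mem_open (mem_univ x₀)
      isOpen_univ).imp fun _ hv => hv.1)
  have hUmem : ∀ i, U i ∈ TopologicalSpace.countableBasis X := fun i => hU ▸ mem_range_self i
  have hUo : ∀ i, IsOpen (U i) := fun i => TopologicalSpace.isOpen_of_mem_countableBasis (hUmem i)
  let A : ℕ → Set X := fun i => {x | ∀ k : ℕ, g^[k] x ∉ U i}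
  have hAclosed : ∀ i, IsClosed (A i) := fun i => by
    simp only [A, ofPred_forall]
    exact isClosed_iInter fun k => ((hUo i).preimage (hg.iterate k)).isClosed_compl
  let K : ℕ → Set X := accumulate A
  have hKclosed : ∀ n, IsClosed (K n) := fun n =>
    (finite_Iic n).isClosed_biUnion fun i _ => hAclosed i
  have hK0 : ∀ n, m (K n) = 0 := fun n =>
    (measure_biUnion_null_iff (finite_Iic n).countable).2 fun i _ =>
      measure_setOf_forall_iterate_notMem_eq_zero hm (hUo i).measurableSet
        (hsupp _ (hUo i) (TopologicalSpace.nonempty_of_mem_countableBasis (hUmem i)))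
  have hKinv : ∀ n, MapsTo g (K n) (K n) := by
    intro n x hx
    obtain ⟨i, hi, hx⟩ := mem_iUnion₂.1 hx
    exact mem_iUnion₂.2 ⟨i, hi, fun k => hx (k + 1)⟩
  have hlim : Tendsto (fun n => ν.real (h ⁻¹' (K n)ᶜ)) atTop (nhds 0) := by
    have hanti : Antitone fun n => h ⁻¹' (K n)ᶜ := fun i j hij =>
      preimage_mono (compl_subset_compl.2 (monotone_accumulate hij))
    have ht := tendsto_measure_iInter_atTop (μ := ν)
      (fun n => (hh (hKclosed n).measurableSet.compl).nullMeasurableSet) hanti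
      ⟨0, measure_ne_top _ _⟩
    have hnull : ν (⋂ n, h ⁻¹' (K n)ᶜ) = 0 := by
      refine measure_mono_null (fun y hy => ?_) hzero
      refine dense_iff_closure_eq.1
        ((TopologicalSpace.isBasis_countableBasis X).dense_iff.2 fun o ho _ => ?_)
      obtain ⟨i, rfl⟩ := hU ▸ ho
      have hyi : h y ∉ A i := fun hyA =>
        mem_iInter.1 hy i (subset_accumulate hyA)
      simp only [A, mem_ofPred_eq, not_forall, not_not] at hyi
      obtain ⟨k, hk⟩ := hyi
      exact ⟨_, hk, mem_range_self k⟩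
    rw [hnull] at ht
    exact (ENNReal.tendsto_toReal ENNReal.zero_ne_top).comp ht
  have hle : c * ∫ x, f x ∂m ≤ 0 := ge_of_tendsto' hlim fun n =>
    mul_integral_le_measureReal_of_null_invariant hg hh hc hconv (hKclosed n) (hK0 n)
      (hKinv n) f.continuous hfc hf01
  exact absurd hle (mul_pos hc hfpos).not_ge
end
end

section
/- Let t₀ > 0 and g = diag(e^{t₀}, e^{−t₀}) ∈ SL₂(ℝ). If s ∈ ℝ is such that the closure of {gᵏ·h₂(s) : k ∈ ℕ} equals X₂, then s is well approximable, i.e., for every c > 0 there exist an integer p and a positive integer q with |s − p/q| < c/q². -/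
open MeasureTheory Matrix Filter Set
open scoped ENNReal

noncomputable section

/-- The lattice `g ℤ²` contains a nonzero vector of sup norm less than `δ`. -/
def HasShortVector (δ : ℝ) (g : SL2R) : Prop :=
  ∃ m n : ℤ, (m ≠ 0 ∨ n ≠ 0) ∧ |g.1 0 0 * m + g.1 0 1 * n| < δ ∧ |g.1 1 0 * m + g.1 1 1 * n| < δ

theorem continuous_entry (i j : Fin 2) : Continuous fun g : SL2R => g.1 i j :=
  (continuous_apply_apply i j).comp continuous_induced_dom

theorem isOpen_hasShortVector (δ : ℝ) : IsOpen {g : SL2R | HasShortVector δ g} := by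
  simp only [HasShortVector, ofPred_exists, ofPred_and]
  refine isOpen_iUnion fun m => isOpen_iUnion fun n => isOpen_const.inter (IsOpen.inter ?_ ?_)
  all_goals
    exact isOpen_lt (((continuous_entry _ _).mul continuous_const).add
      ((continuous_entry _ _).mul continuous_const)).abs continuous_const

theorem HasShortVector.of_mul_map {δ : ℝ} {g : SL2R} (γ : SL2Z)
    (h : HasShortVector δ (g * Matrix.SpecialLinearGroup.map (Int.castRingHom ℝ) γ)) :
    HasShortVector δ g := by
  obtain ⟨m, n, h0, h1, h2⟩ := h
  have hdet := γ.2
  rw [Matrix.det_fin_two] at hdet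
  simp only [Matrix.SpecialLinearGroup.coe_mul, Matrix.mul_apply, Fin.sum_univ_two,
    Matrix.SpecialLinearGroup.map_apply_coe, RingHom.mapMatrix_apply, Matrix.map_apply,
    eq_intCast] at h1 h2
  refine ⟨γ.1 0 0 * m + γ.1 0 1 * n, γ.1 1 0 * m + γ.1 1 1 * n, ?_, ?_, ?_⟩
  · by_contra! H
    obtain ⟨H0, H1⟩ := H
    have hm : m = 0 := by linear_combination γ.1 1 1 * H0 - γ.1 0 1 * H1 - m * hdet
    have hn : n = 0 := by linear_combination γ.1 0 0 * H1 - γ.1 1 0 * H0 - n * hdet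
    tauto
  · convert h1 using 2
    push_cast
    ring
  · convert h2 using 2
    push_cast
    ring

/-- The set of unimodular lattices with a nonzero vector of sup norm less than `δ`. -/
def shortVectorSet (δ : ℝ) : Set X2 :=
  QuotientGroup.mk '' {g : SL2R | HasShortVector δ g}

theorem mk_mem_shortVectorSet {δ : ℝ} {g : SL2R} :
    (QuotientGroup.mk g : X2) ∈ shortVectorSet δ ↔ HasShortVector δ g := by
  refine ⟨?_, fun h => ⟨g, h, rfl⟩⟩
  rintro ⟨g', hg', h⟩
  obtain ⟨γ, hγ⟩ := QuotientGroup.eq.mp h.symm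
  refine HasShortVector.of_mul_map γ ?_
  rw [hγ, mul_inv_cancel_left]
  exact hg'

theorem isOpen_shortVectorSet (δ : ℝ) : IsOpen (shortVectorSet δ) := by
  refine isOpen_coinduced.mpr ?_
  convert isOpen_hasShortVector δ using 1
  ext g
  exact mk_mem_shortVectorSet

theorem shortVectorSet_nonempty {δ : ℝ} (hδ : 0 < δ) : (shortVectorSet δ).Nonempty := by
  refine ⟨QuotientGroup.mk (g2 (Real.log (δ / 2))), mk_mem_shortVectorSet.mpr ⟨1, 0, by simp, ?_, ?_⟩⟩
  · simp only [g2, Matrix.of_apply, Matrix.cons_val_zero, Matrix.cons_val_one]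
    rw [Real.exp_log (by positivity)]
    simpa [abs_of_pos (half_pos hδ)] using hδ
  · simpa [g2] using hδ

theorem g2_mul (t u : ℝ) : g2 t * g2 u = g2 (t + u) := by
  refine Subtype.ext ((Matrix.SpecialLinearGroup.coe_mul _ _).trans ?_)
  simp [g2, ← Real.exp_add, add_comm]

/-- The upper unipotent matrix `[[1, s], [0, 1]]`, whose class is `h2 s`. -/
def unipotent (s : ℝ) : SL2R :=
  ⟨!![(1 : ℝ), s; 0, 1], by simp⟩

theorem coe_g2_mul_unipotent (t s : ℝ) :
    (g2 t * unipotent s).1 =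
      !![Real.exp t, Real.exp t * s; 0, Real.exp (-t)] :=
  (Matrix.SpecialLinearGroup.coe_mul _ _).trans (by simp [g2, unipotent])

/-- Integers `m` and `n ≠ 0` with `|n (m + s n)| < c` give a rational approximation to `s`. -/
theorem exists_approx_of_abs_mul_lt {s c : ℝ} {m n : ℤ} (hn : n ≠ 0)
    (h : |(n : ℝ) * (m + s * n)| < c) :
    ∃ (p : ℤ) (q : ℕ), 0 < q ∧ |s - (p : ℝ) / (q : ℝ)| < c / (q : ℝ) ^ 2 := by
  refine ⟨-m * n.sign, n.natAbs, Int.natAbs_pos.mpr hn, ?_⟩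
  have hn' : (n : ℝ) ≠ 0 := Int.cast_ne_zero.mpr hn
  have hsgn : ((n.sign : ℤ) : ℝ) * |(n : ℝ)| = n := by exact_mod_cast Int.sign_mul_abs n
  have hs : s - ((-m * n.sign : ℤ) : ℝ) / |(n : ℝ)| = (n * (m + s * n)) / (n : ℝ) ^ 2 := by
    have : |(n : ℝ)| ≠ 0 := abs_ne_zero.mpr hn'
    rw [← sq_abs (n : ℝ)]
    field_simp
    push_cast
    linear_combination s * sq_abs (n : ℝ) + m * hsgn
  rw [Nat.cast_natAbs, Int.cast_abs, hs, abs_div, abs_sq, sq_abs]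
  gcongr

theorem wellapproximable_of_dense_orbit (t₀ : ℝ) (ht₀ : 0 < t₀) (s : ℝ)
    (hs : closure (Set.range fun k : ℕ => (g2 t₀) ^ k • h2 s) = Set.univ) :
    ∀ c : ℝ, 0 < c → ∃ (p : ℤ) (q : ℕ), 0 < q ∧
      |s - (p : ℝ) / (q : ℝ)| < c / (q : ℝ) ^ 2 := by
  intro c hc
  set δ := min 1 √c
  have hδ : 0 < δ := lt_min one_pos (Real.sqrt_pos.mpr hc)
  have hdense : Dense (Set.range fun k : ℕ => (g2 t₀) ^ k • h2 s) :=
    dense_iff_closure_eq.mpr hs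
  obtain ⟨_, hx, k, rfl⟩ :=
    hdense.inter_open_nonempty _ (isOpen_shortVectorSet δ) (shortVectorSet_nonempty hδ)
  set T := (k : ℝ) * t₀ with hTdef
  have hT : 0 ≤ T := by positivity
  have hx' : (QuotientGroup.mk (g2 T * unipotent s) : X2) ∈ shortVectorSet δ := by
    rw [hTdef, ← g2_pow]
    exact hx
  obtain ⟨m, n, h0, h1, h2⟩ := mk_mem_shortVectorSet.mp hx'
  rw [coe_g2_mul_unipotent] at h1 h2
  simp only [Matrix.of_apply, Matrix.cons_val_zero, Matrix.cons_val_one, Matrix.cons_val',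
    Matrix.cons_val_fin_one, zero_mul, zero_add] at h1 h2
  have hn : n ≠ 0 := by
    rintro rfl
    have hm : (1 : ℝ) ≤ |(m : ℝ)| := by
      exact_mod_cast Int.one_le_abs (h0.resolve_right (by simp))
    have hlt : Real.exp T * |(m : ℝ)| < 1 := by
      refine lt_of_lt_of_le ?_ (min_le_left 1 √c)
      rw [Int.cast_zero, mul_zero, add_zero, abs_mul, Real.abs_exp] at h1
      exact h1
    nlinarith [Real.one_le_exp hT]
  refine exists_approx_of_abs_mul_lt (m := m) hn ?_
  have hprod : (n : ℝ) * (m + s * n) =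
      (Real.exp T * m + Real.exp T * s * n) * (Real.exp (-T) * n) := by
    have := Real.exp_add T (-T)
    rw [add_neg_cancel, Real.exp_zero] at this
    linear_combination (n : ℝ) * (m + s * n) * this
  rw [hprod, abs_mul]
  calc _ < δ * δ := mul_lt_mul'' h1 h2 (abs_nonneg _) (abs_nonneg _)
    _ ≤ √c * √c := by gcongr <;> exact min_le_right _ _
    _ = c := Real.mul_self_sqrt hc.le
end
end
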